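/- Let d ≥ 1, let F : ℝ^d → ℝ be bounded below with infimum F⋆ and have L-Lipschitz continuous gradient. Fix constants C, β₁, β₂ > 0, set β = min{β₁, β₂}, fix η ∈ [1/2, 1) and a step-size parameter a > 0 with a ≤ min{1, β₂/(8C²), (1−η)β₁/(8C²(LC + (1−η)‖∇F(x¹)‖))}, and set α_t = a/(t+1)^η. On a probability space with filtration (𝓕_t)_{t≥1}, let x¹ ∈ ℝ^d be deterministic and for each t ≥ 1 let u^t be an 𝓕_{t+1}-measurable random vector with ‖u^t‖ ≤ C almost surely, and define iterates by x^{t+1} = x^t − α_t u^t (so each x^t is 𝓕_t-measurable). Assume the drift condition: for each t, almost surely ⟨E[u^t | 𝓕_t], ∇F(x^t)⟩ ≥ min{β₁‖∇F(x^t)‖, β₂‖∇F(x^t)‖²}. Then for every t ≥ 1 and every δ ∈ (0,1), with probability at least 1 − δ, (1/t)·Σ_{k=1}^t min{‖∇F(x^k)‖, ‖∇F(x^k)‖²} ≤ 4(log(1/δ) + F(x¹) − F⋆)/(a β t^{1−η}) + (2 a L C²/(β t^{1−η}))·Σ_{k=1}^t (k+1)^{−2η}. -/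

import Mathlib

open MeasureTheory RealInnerProductSpace

/-- The descent lemma: a function with `L`-Lipschitz gradient lies below its quadratic models. -/
theorem le_quadratic_of_lipschitz_gradient {E : Type*} [NormedAddCommGroup E]
    [InnerProductSpace ℝ E] [CompleteSpace E] {F : E → ℝ} {L : ℝ} (hF : Differentiable ℝ F)
    (hlip : ∀ x y : E, ‖gradient F x - gradient F y‖ ≤ L * ‖x - y‖) (x v : E) :
    F (x + v) ≤ F x + ⟪gradient F x, v⟫ + L / 2 * ‖v‖ ^ 2 := by
  set h : ℝ → ℝ := fun s => F (x + s • v) - s * ⟪gradient F x, v⟫ - L / 2 * ‖v‖ ^ 2 * s ^ 2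
  have hd (s : ℝ) : HasDerivAt h
      (⟪gradient F (x + s • v), v⟫ - ⟪gradient F x, v⟫ - L / 2 * ‖v‖ ^ 2 * (2 * s)) s := by
    have h1 : HasDerivAt (fun s : ℝ => x + s • v) v s := by
      simpa using ((hasDerivAt_id s).smul_const v).const_add x
    have h2 := (hF (x + s • v)).hasGradientAt.hasFDerivAt.comp_hasDerivAt s h1
    have h3 := (hasDerivAt_id s).mul_const ⟪gradient F x, v⟫
    have h4 := ((hasDerivAt_id s).pow 2).const_mul (L / 2 * ‖v‖ ^ 2)
    exact ((h2.sub h3).sub h4).congr_deriv (by simp)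
  have hanti : AntitoneOn h (Set.Icc 0 1) := by
    refine antitoneOn_of_deriv_nonpos (convex_Icc 0 1)
      (fun s _ => (hd s).continuousAt.continuousWithinAt)
      (fun s _ => (hd s).differentiableAt.differentiableWithinAt) fun s hs => ?_
    rw [interior_Icc] at hs
    rw [(hd s).deriv, ← inner_sub_left]
    have h1 := real_inner_le_norm (gradient F (x + s • v) - gradient F x) v
    have h2 := hlip (x + s • v) x
    rw [add_sub_cancel_left, norm_smul, Real.norm_of_nonneg hs.1.le] at h2
    nlinarith [mul_le_mul_of_nonneg_right h2 (norm_nonneg v)]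
  have := hanti (Set.left_mem_Icc.2 zero_le_one) (Set.right_mem_Icc.2 zero_le_one) zero_le_one
  simp only [h, one_smul, zero_smul, add_zero] at this
  linarith

/-- A lower bound for the conditional mean of `Y` lies below any measurable bound on `|Y|`. -/
theorem ae_le_of_ae_le_condExp {Ω : Type*} {m m0 : MeasurableSpace Ω} {P : Measure Ω}
    [IsFiniteMeasure P] (hm : m ≤ m0) {Y z c : Ω → ℝ} {K : ℝ} (hY : AEStronglyMeasurable Y P)
    (hc : StronglyMeasurable[m] c) (hcK : ∀ᵐ ω ∂P, c ω ≤ K)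
    (hYc : ∀ᵐ ω ∂P, |Y ω| ≤ c ω) (hzY : ∀ᵐ ω ∂P, z ω ≤ (P[Y | m]) ω) :
    ∀ᵐ ω ∂P, z ω ≤ c ω := by
  have hYint : Integrable Y P := by
    refine .of_bound hY K ?_
    filter_upwards [hcK, hYc] with ω h1 h2
    exact h2.trans h1
  have hcint : Integrable c P := by
    refine .of_bound (hc.mono hm).aestronglyMeasurable K ?_
    filter_upwards [hcK, hYc] with ω h1 h2
    rwa [Real.norm_of_nonneg ((abs_nonneg _).trans h2)]
  have h1 : P[Y | m] ≤ᵐ[P] P[c | m] := condExp_mono hYint hcint <| by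
    filter_upwards [hYc] with ω h using (le_abs_self _).trans h
  rw [condExp_of_stronglyMeasurable hm hc hcint] at h1
  filter_upwards [h1, hzY] with ω h2 h3 using h3.trans h2

/-- A one-step exponential supermartingale bound for a bounded variable `Y` whose conditional
mean is at least `z`, where `z` dominates twice the square of the bound on `Y`. -/
theorem integral_mul_exp_half_sub_le {Ω : Type*} {m m0 : MeasurableSpace Ω} {P : Measure Ω}
    [IsFiniteMeasure P] (hm : m ≤ m0) {W Y z c : Ω → ℝ} {B K : ℝ}
    (hW : StronglyMeasurable[m] W) (hW0 : ∀ ω, 0 ≤ W ω) (hWB : ∀ᵐ ω ∂P, W ω ≤ B)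
    (hY : AEStronglyMeasurable Y P) (hz : StronglyMeasurable[m] z)
    (hc : StronglyMeasurable[m] c) (hcK : ∀ᵐ ω ∂P, c ω ≤ K)
    (hYc : ∀ᵐ ω ∂P, |Y ω| ≤ c ω) (hzY : ∀ᵐ ω ∂P, z ω ≤ (P[Y | m]) ω)
    (hcz : ∀ᵐ ω ∂P, c ω ^ 2 ≤ z ω / 2) :
    ∫ ω, W ω * Real.exp (z ω / 2 - Y ω) ∂P ≤ ∫ ω, W ω ∂P := by
  have hYint : Integrable Y P := by
    refine .of_bound hY K ?_
    filter_upwards [hcK, hYc] with ω h1 h2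
    exact h2.trans h1
  have hzc := ae_le_of_ae_le_condExp hm hY hc hcK hYc hzY
  set A : Ω → ℝ := fun ω => W ω * Real.exp (z ω / 2)
  have hA : StronglyMeasurable[m] A :=
    hW.mul (Real.continuous_exp.comp_stronglyMeasurable
      ((continuous_id.div_const 2).comp_stronglyMeasurable hz))
  have hA' := (hA.mono hm).aestronglyMeasurable (μ := P)
  have hA0 (ω) : 0 ≤ A ω := mul_nonneg (hW0 ω) (Real.exp_pos _).le
  have hAB : ∀ᵐ ω ∂P, ‖A ω‖ ≤ B * Real.exp (K / 2) := by
    filter_upwards [hWB, hzc, hcK] with ω h1 h2 h3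
    rw [Real.norm_of_nonneg (hA0 ω)]
    have := h2.trans h3
    have := (hW0 ω).trans h1
    simp only [A]
    gcongr
  have hc2 : Integrable (fun ω => 1 + c ω ^ 2) P := by
    refine (integrable_const 1).add (.of_bound ((hc.mono hm).aestronglyMeasurable.pow 2) (K ^ 2) ?_)
    filter_upwards [hcK, hYc] with ω h1 h2
    have := (abs_nonneg _).trans h2
    simp only [norm_pow, Real.norm_of_nonneg this]
    gcongr
  have hAc : Integrable (fun ω => A ω * (1 + c ω ^ 2)) P := hc2.bdd_mul hA' hAB
  have hAY : Integrable (fun ω => A ω * Y ω) P := hYint.bdd_mul hA' hAB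
  have hAE : Integrable (fun ω => A ω * (P[Y | m]) ω) P :=
    integrable_condExp.bdd_mul hA' hAB
  have hpull : ∫ ω, A ω * Y ω ∂P = ∫ ω, A ω * (P[Y | m]) ω ∂P := by
    rw [← integral_condExp hm]
    exact integral_congr_ae (condExp_mul_of_stronglyMeasurable_left hA hAY hYint)
  calc ∫ ω, W ω * Real.exp (z ω / 2 - Y ω) ∂P
      ≤ ∫ ω, (A ω * (1 + c ω ^ 2) - A ω * Y ω) ∂P := by
        refine integral_mono_of_nonneg (.of_forall fun ω =>
          mul_nonneg (hW0 ω) (Real.exp_pos _).le) (hAc.sub hAY) ?_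
        filter_upwards [hYc, hzc, hcz] with ω h1 h2 h3
        have h0 := (abs_nonneg _).trans h1
        have h4 : c ω ≤ 1 := by nlinarith
        have h5 := Real.abs_exp_sub_one_sub_id_le (x := -Y ω) (by rw [abs_neg]; linarith)
        have h6 : Y ω ^ 2 ≤ c ω ^ 2 := sq_le_sq' (abs_le.1 h1).1 (abs_le.1 h1).2
        have h7 : Real.exp (-Y ω) ≤ 1 + c ω ^ 2 - Y ω := by
          linarith [(abs_le.1 h5).2, neg_sq (Y ω)]
        simp only [A]
        rw [sub_eq_add_neg, Real.exp_add, ← mul_assoc, ← mul_sub]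
        exact mul_le_mul_of_nonneg_left h7 (hA0 ω)
    _ = ∫ ω, (A ω * (1 + c ω ^ 2) - A ω * (P[Y | m]) ω) ∂P := by
        rw [integral_sub hAc hAY, integral_sub hAc hAE, hpull]
    _ ≤ ∫ ω, W ω ∂P := by
        refine integral_mono_ae (hAc.sub hAE) (.of_bound (hW.mono hm).aestronglyMeasurable B ?_) ?_
        · filter_upwards [hWB] with ω h
          rwa [Real.norm_of_nonneg (hW0 ω)]
        · filter_upwards [hzY, hcz] with ω h1 h2
          have h3 : 1 + c ω ^ 2 - (P[Y | m]) ω ≤ Real.exp (-(z ω / 2)) := by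
            linarith [Real.add_one_le_exp (-(z ω / 2))]
          calc A ω * (1 + c ω ^ 2) - A ω * (P[Y | m]) ω
              = A ω * (1 + c ω ^ 2 - (P[Y | m]) ω) := by ring
            _ ≤ A ω * Real.exp (-(z ω / 2)) := mul_le_mul_of_nonneg_left h3 (hA0 ω)
            _ = W ω := by simp only [A]; rw [mul_assoc, ← Real.exp_add]; simp

/-- The exponential supermartingale built from bounded increments `Y k` has mean at most one. -/
theorem integral_exp_sum_half_sub_le_one {Ω : Type*} {m0 : MeasurableSpace Ω} {P : Measure Ω}
    [IsProbabilityMeasure P] {ℱ : Filtration ℕ m0} {Y z c : ℕ → Ω → ℝ} {K : ℕ → ℝ}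
    (hY : ∀ k, 1 ≤ k → StronglyMeasurable[ℱ (k + 1)] (Y k))
    (hz : ∀ k, 1 ≤ k → StronglyMeasurable[ℱ k] (z k))
    (hc : ∀ k, 1 ≤ k → StronglyMeasurable[ℱ k] (c k))
    (hcK : ∀ k, 1 ≤ k → ∀ᵐ ω ∂P, c k ω ≤ K k)
    (hYc : ∀ k, 1 ≤ k → ∀ᵐ ω ∂P, |Y k ω| ≤ c k ω)
    (hzY : ∀ k, 1 ≤ k → ∀ᵐ ω ∂P, z k ω ≤ (P[Y k | ℱ k]) ω)
    (hcz : ∀ k, 1 ≤ k → ∀ᵐ ω ∂P, c k ω ^ 2 ≤ z k ω / 2) (t : ℕ) :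
    StronglyMeasurable[ℱ (t + 1)] (fun ω => ∑ k ∈ Finset.Icc 1 t, (z k ω / 2 - Y k ω)) ∧
    Integrable (fun ω => Real.exp (∑ k ∈ Finset.Icc 1 t, (z k ω / 2 - Y k ω))) P ∧
    ∫ ω, Real.exp (∑ k ∈ Finset.Icc 1 t, (z k ω / 2 - Y k ω)) ∂P ≤ 1 := by
  have hmeas (t : ℕ) : StronglyMeasurable[ℱ (t + 1)]
      (fun ω => ∑ k ∈ Finset.Icc 1 t, (z k ω / 2 - Y k ω)) := by
    refine Finset.stronglyMeasurable_fun_sum _ fun k hk => ?_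
    rw [Finset.mem_Icc] at hk
    exact ((continuous_id.div_const 2).comp_stronglyMeasurable
      ((hz k hk.1).mono (ℱ.mono (by omega)))).sub ((hY k hk.1).mono (ℱ.mono (by omega)))
  have hexp (t : ℕ) : StronglyMeasurable[ℱ (t + 1)]
      (fun ω => Real.exp (∑ k ∈ Finset.Icc 1 t, (z k ω / 2 - Y k ω))) :=
    Real.continuous_exp.comp_stronglyMeasurable (hmeas t)
  have hbdd (t : ℕ) : ∀ᵐ ω ∂P, Real.exp (∑ k ∈ Finset.Icc 1 t, (z k ω / 2 - Y k ω)) ≤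
      Real.exp (∑ k ∈ Finset.Icc 1 t, (K k / 2 + K k)) := by
    have h : ∀ᵐ ω ∂P, ∀ k, 1 ≤ k → z k ω / 2 - Y k ω ≤ K k / 2 + K k := by
      refine ae_all_iff.2 fun k => ae_all_iff.2 fun hk => ?_
      filter_upwards [hcK k hk, hYc k hk, ae_le_of_ae_le_condExp (ℱ.le k)
        ((hY k hk).mono (ℱ.le _)).aestronglyMeasurable (hc k hk) (hcK k hk) (hYc k hk)
        (hzY k hk)] with ω h1 h2 h3
      linarith [(abs_le.1 h2).1]
    filter_upwards [h] with ω h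
    exact Real.exp_le_exp.2 (Finset.sum_le_sum fun k hk => h k (Finset.mem_Icc.1 hk).1)
  refine ⟨hmeas t, .of_bound ((hexp t).mono (ℱ.le _)).aestronglyMeasurable
    (Real.exp (∑ k ∈ Finset.Icc 1 t, (K k / 2 + K k))) ?_, ?_⟩
  · filter_upwards [hbdd t] with ω h
    rwa [Real.norm_of_nonneg (Real.exp_pos _).le]
  · induction t with
    | zero => simp
    | succ t ih =>
      have h1 : 1 ≤ t + 1 := by omega
      refine le_trans (le_of_eq ?_) ((integral_mul_exp_half_sub_le (ℱ.le (t + 1)) (hexp t)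
        (fun ω => (Real.exp_pos _).le) (hbdd t)
        ((hY _ h1).mono (ℱ.le _)).aestronglyMeasurable (hz _ h1) (hc _ h1) (hcK _ h1)
        (hYc _ h1) (hzY _ h1) (hcz _ h1)).trans ih)
      simp only [Finset.sum_Icc_succ_top h1, Real.exp_add]

/-- One step of the comparison of `∑ (k + 1) ^ (-η)` with `t ^ (1 - η) / (1 - η)`. -/
theorem rpow_add_mul_rpow_neg_le {t η : ℝ} (ht : 0 ≤ t) (hη0 : 0 ≤ η) (hη1 : η ≤ 1) :
    t ^ (1 - η) + (1 - η) * (1 / (t + 1) ^ η) ≤ (t + 1) ^ (1 - η) := by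
  have ht1 : 0 < t + 1 := by linarith
  have hs : -1 ≤ -(1 / (t + 1)) := by
    rw [neg_le_neg_iff, div_le_one ht1]
    linarith
  have hb := rpow_one_add_le_one_add_mul_self hs (sub_nonneg.2 hη1) (sub_le_self 1 hη0)
  have hfac : (t + 1) * (1 + -(1 / (t + 1))) = t := by field_simp; ring
  have hpow : (t + 1) ^ (1 - η) = (t + 1) * (1 / (t + 1) ^ η) := by
    rw [Real.rpow_sub ht1, Real.rpow_one, mul_one_div]
  calc t ^ (1 - η) + (1 - η) * (1 / (t + 1) ^ η)
      = (t + 1) ^ (1 - η) * (1 + -(1 / (t + 1))) ^ (1 - η) + (1 - η) * (1 / (t + 1) ^ η) := by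
        rw [← Real.mul_rpow ht1.le (by linarith), hfac]
    _ ≤ (t + 1) ^ (1 - η) * (1 + (1 - η) * -(1 / (t + 1))) + (1 - η) * (1 / (t + 1) ^ η) := by
        gcongr
    _ = (t + 1) ^ (1 - η) := by
        rw [hpow]
        field_simp
        ring

section BoundedDirections

variable {E : Type*} [NormedAddCommGroup E] [InnerProductSpace ℝ E] [CompleteSpace E]
  {F : E → ℝ} {L C η a : ℝ} {x u : ℕ → E}

/-- Along iterates with bounded directions and steps `a / (t + 1) ^ η`, the gradient norm grows
at most like `t ^ (1 - η)`. -/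
theorem norm_gradient_iterate_le
    (hlip : ∀ x y : E, ‖gradient F x - gradient F y‖ ≤ L * ‖x - y‖) (hL : 0 ≤ L) (hC : 0 ≤ C)
    (hη0 : 0 ≤ η) (hη1 : η < 1) (ha : 0 ≤ a) (hu : ∀ t, 1 ≤ t → ‖u t‖ ≤ C)
    (hrec : ∀ t : ℕ, 1 ≤ t → x (t + 1) = x t - (a / ((t : ℝ) + 1) ^ η) • u t)
    {t : ℕ} (ht : 1 ≤ t) :
    ‖gradient F (x t)‖ ≤ ‖gradient F (x 1)‖ + L * C * a / (1 - η) * (t : ℝ) ^ (1 - η) := by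
  have h1η : 0 < 1 - η := sub_pos.2 hη1
  induction t, ht using Nat.le_induction with
  | base => simpa using by positivity
  | succ t ht ih =>
    have hα : 0 ≤ a / ((t : ℝ) + 1) ^ η := by positivity
    have h1 : ‖gradient F (x (t + 1)) - gradient F (x t)‖ ≤ L * (a / ((t : ℝ) + 1) ^ η * C) := by
      refine (hlip _ _).trans (mul_le_mul_of_nonneg_left ?_ hL)
      rw [hrec t ht, sub_sub_cancel_left, norm_neg, norm_smul, Real.norm_of_nonneg hα]
      exact mul_le_mul_of_nonneg_left (hu t ht) hα
    have h2 : L * C * a / (1 - η) * (t : ℝ) ^ (1 - η) + L * (a / ((t : ℝ) + 1) ^ η * C) ≤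
        L * C * a / (1 - η) * ((t : ℝ) + 1) ^ (1 - η) := by
      calc _ = L * C * a / (1 - η) *
              ((t : ℝ) ^ (1 - η) + (1 - η) * (1 / ((t : ℝ) + 1) ^ η)) := by field_simp
        _ ≤ _ := mul_le_mul_of_nonneg_left
            (rpow_add_mul_rpow_neg_le t.cast_nonneg hη0 hη1.le) (by positivity)
    have h3 := norm_sub_norm_le (gradient F (x (t + 1))) (gradient F (x t))
    push_cast
    linarith

/-- The telescoped descent inequality along iterates with bounded directions. -/
theorem iterate_le_sub_sum_inner (hF : Differentiable ℝ F)
    (hlip : ∀ x y : E, ‖gradient F x - gradient F y‖ ≤ L * ‖x - y‖) (hL : 0 ≤ L)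
    {α : ℕ → ℝ} (hu : ∀ t, 1 ≤ t → ‖u t‖ ≤ C)
    (hrec : ∀ t : ℕ, 1 ≤ t → x (t + 1) = x t - α t • u t) (t : ℕ) :
    F (x (t + 1)) ≤ F (x 1) - ∑ k ∈ Finset.Icc 1 t, α k * ⟪u k, gradient F (x k)⟫ +
      L * C ^ 2 / 2 * ∑ k ∈ Finset.Icc 1 t, α k ^ 2 := by
  induction t with
  | zero => simp
  | succ t ih =>
    have ht : 1 ≤ t + 1 := by omega
    rw [Finset.sum_Icc_succ_top ht, Finset.sum_Icc_succ_top ht, hrec _ ht,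
      sub_eq_add_neg (x (t + 1))]
    have h1 := le_quadratic_of_lipschitz_gradient hF hlip (x (t + 1)) (-(α (t + 1) • u (t + 1)))
    rw [inner_neg_right, inner_smul_right, real_inner_comm, norm_neg, norm_smul, mul_pow,
      Real.norm_eq_abs, sq_abs] at h1
    have h2 : L / 2 * (α (t + 1) ^ 2 * ‖u (t + 1)‖ ^ 2) ≤ L / 2 * (α (t + 1) ^ 2 * C ^ 2) := by
      have := hu _ ht
      gcongr
    linarith

end BoundedDirections

/-- The step-size restrictions make the second-order term of the exponential bound at most an
eighth of the drift. -/
theorem sq_step_mul_le_drift {β₁ β₂ C L η a G n : ℝ} {t : ℕ} (hC : 0 < C)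
    (hL : 0 ≤ L) (hη1 : 1 / 2 ≤ η) (hη2 : η < 1) (ha0 : 0 < a) (hG : 0 ≤ G)
    (ha : a ≤ min 1 (min (β₂ / (8 * C ^ 2))
      ((1 - η) * β₁ / (8 * C ^ 2 * (L * C + (1 - η) * G)))))
    (ht : 1 ≤ t) (hn : 0 ≤ n) (hnG : n ≤ G + L * C * a / (1 - η) * (t : ℝ) ^ (1 - η)) :
    (a / ((t : ℝ) + 1) ^ η * C * n) ^ 2 ≤
      a / ((t : ℝ) + 1) ^ η * min (β₁ * n) (β₂ * n ^ 2) / 8 := by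
  obtain ⟨ha1, ha2, ha3⟩ : a ≤ 1 ∧ a ≤ β₂ / (8 * C ^ 2) ∧
      a ≤ (1 - η) * β₁ / (8 * C ^ 2 * (L * C + (1 - η) * G)) := by
    simpa only [le_min_iff] using ha
  have h1η : 0 < 1 - η := sub_pos.2 hη2
  have hD : 0 < L * C + (1 - η) * G := by
    refine lt_of_le_of_ne (by positivity) fun h => ?_
    rw [← h, mul_zero, div_zero] at ha3
    linarith
  rw [le_div_iff₀ (by positivity)] at ha2 ha3
  have ht' : (1 : ℝ) ≤ t := by exact_mod_cast ht
  set q : ℝ := ((t : ℝ) + 1) ^ η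
  have hq1 : 1 ≤ q := Real.one_le_rpow (by linarith) (by linarith)
  have hq0 : 0 < q := by linarith
  have htq : (t : ℝ) ^ (1 - η) ≤ q :=
    (Real.rpow_le_rpow_of_exponent_le ht' (by linarith)).trans
      (Real.rpow_le_rpow (by linarith) (by linarith) (by linarith))
  have hαn : a / q * n * (8 * C ^ 2) ≤ β₁ := by
    have h1 : n ≤ q * ((L * C + (1 - η) * G) / (1 - η)) := by
      calc n ≤ G + L * C * a / (1 - η) * (t : ℝ) ^ (1 - η) := hnG
        _ ≤ q * G + L * C * 1 / (1 - η) * q := by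
          gcongr
          exact le_mul_of_one_le_left hG hq1
        _ = q * ((L * C + (1 - η) * G) / (1 - η)) := by field_simp; ring
    calc a / q * n * (8 * C ^ 2)
        ≤ a / q * (q * ((L * C + (1 - η) * G) / (1 - η))) * (8 * C ^ 2) := by gcongr
      _ = a * (8 * C ^ 2 * (L * C + (1 - η) * G)) / (1 - η) := by field_simp
      _ ≤ β₁ := by rw [div_le_iff₀ h1η]; linarith
  have hα : a / q * (8 * C ^ 2) ≤ β₂ := by
    refine le_trans ?_ ha2
    gcongr
    exact div_le_self ha0.le hq1
  have hα0 : 0 ≤ a / q := by positivity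
  have hmin : a / q * (8 * C ^ 2) * n ^ 2 ≤ min (β₁ * n) (β₂ * n ^ 2) := by
    refine le_min ?_ (mul_le_mul_of_nonneg_right hα (sq_nonneg n))
    linarith [mul_le_mul_of_nonneg_right hαn hn]
  linarith [mul_le_mul_of_nonneg_left hmin hα0]

/-- Converting a weighted bound with weights `a / (k + 1) ^ η` into a bound on the average. -/
theorem average_le_of_weighted_sum_le {β₁ β₂ η a R : ℝ} {n : ℕ → ℝ} {t : ℕ} (ht : 1 ≤ t)
    (hβ₁ : 0 < β₁) (hβ₂ : 0 < β₂) (hη0 : 0 ≤ η) (hη1 : η ≤ 1) (ha : 0 < a) (hn : ∀ k, 0 ≤ n k)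
    (h : ∑ k ∈ Finset.Icc 1 t,
      a / ((k : ℝ) + 1) ^ η * min (β₁ * n k) (β₂ * n k ^ 2) / 2 ≤ R) :
    (1 / (t : ℝ)) * ∑ k ∈ Finset.Icc 1 t, min (n k) (n k ^ 2) ≤
      4 * R / (a * min β₁ β₂ * (t : ℝ) ^ (1 - η)) := by
  set β := min β₁ β₂
  have hβ : 0 < β := lt_min hβ₁ hβ₂
  have ht' : (1 : ℝ) ≤ t := by exact_mod_cast ht
  have ht0 : (0 : ℝ) < t := by linarith
  have hq0 : 0 < (t : ℝ) ^ η := by positivity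
  have hq : ((t : ℝ) + 1) ^ η ≤ 2 * (t : ℝ) ^ η := by
    calc ((t : ℝ) + 1) ^ η ≤ (2 * t) ^ η := by gcongr; linarith
      _ = 2 ^ η * (t : ℝ) ^ η := Real.mul_rpow (by norm_num) ht0.le
      _ ≤ 2 ^ (1 : ℝ) * (t : ℝ) ^ η := by gcongr; norm_num
      _ = 2 * (t : ℝ) ^ η := by rw [Real.rpow_one]
  have hsum : a * β / (4 * (t : ℝ) ^ η) * ∑ k ∈ Finset.Icc 1 t, min (n k) (n k ^ 2) ≤ R := by
    refine le_trans ?_ h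
    rw [Finset.mul_sum]
    refine Finset.sum_le_sum fun k hk => ?_
    have hkt : (k : ℝ) ≤ t := by exact_mod_cast (Finset.mem_Icc.1 hk).2
    have hm0 : 0 ≤ min (n k) (n k ^ 2) := le_min (hn k) (sq_nonneg _)
    have hm : β * min (n k) (n k ^ 2) ≤ min (β₁ * n k) (β₂ * n k ^ 2) :=
      le_min (mul_le_mul (min_le_left _ _) (min_le_left _ _) hm0 hβ₁.le)
        (mul_le_mul (min_le_right _ _) (min_le_right _ _) hm0 hβ₂.le)
    have hw : a / (2 * (t : ℝ) ^ η) ≤ a / ((k : ℝ) + 1) ^ η := by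
      gcongr
      exact le_trans (by gcongr) hq
    calc a * β / (4 * (t : ℝ) ^ η) * min (n k) (n k ^ 2)
        = a / (2 * (t : ℝ) ^ η) * (β * min (n k) (n k ^ 2)) / 2 := by ring
      _ ≤ _ := by gcongr
  have hpow : (t : ℝ) ^ (1 - η) = t / (t : ℝ) ^ η := by
    rw [Real.rpow_sub ht0, Real.rpow_one]
  calc (1 / (t : ℝ)) * ∑ k ∈ Finset.Icc 1 t, min (n k) (n k ^ 2)
      = 4 / (a * β * (t : ℝ) ^ (1 - η)) *
        (a * β / (4 * (t : ℝ) ^ η) * ∑ k ∈ Finset.Icc 1 t, min (n k) (n k ^ 2)) := by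
        rw [hpow]; field_simp
    _ ≤ 4 / (a * β * (t : ℝ) ^ (1 - η)) * R := by gcongr
    _ = _ := by ring

/-- Chernoff's bound for a random variable whose exponential moment is at most one. -/
theorem ofReal_one_sub_le_measure_lt_log {Ω : Type*} {m0 : MeasurableSpace Ω} {P : Measure Ω}
    [IsProbabilityMeasure P] {S : Ω → ℝ} (hS : Measurable S)
    (hint : Integrable (fun ω => Real.exp (S ω)) P) (hle : ∫ ω, Real.exp (S ω) ∂P ≤ 1)
    {δ : ℝ} (hδ : 0 < δ) :
    ENNReal.ofReal (1 - δ) ≤ P {ω | S ω < Real.log (1 / δ)} := by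
  have hset : {ω | S ω < Real.log (1 / δ)} = {ω | 1 / δ ≤ Real.exp (S ω)}ᶜ := by
    ext ω
    simp only [Set.mem_ofPred_eq, Set.mem_compl_iff, not_le,
      Real.lt_log_iff_exp_lt (one_div_pos.2 hδ)]
  have hM := mul_meas_ge_le_integral_of_nonneg
    (.of_forall fun ω => (Real.exp_pos (S ω)).le) hint (1 / δ)
  have hδ' : P.real {ω | 1 / δ ≤ Real.exp (S ω)} ≤ δ := by
    have := hM.trans hle
    rwa [one_div_mul_eq_div, div_le_one hδ] at this
  rw [hset, ← ofReal_measureReal,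
    probReal_compl_eq_one_sub (measurableSet_le measurable_const hS.exp)]
  exact ENNReal.ofReal_le_ofReal (by linarith)

/-- High-probability convergence of nonlinear SGD under state-dependent symmetric
heavy-tailed noise (the paper's Theorem 1, in process form): for iterates
`x^{t+1} = x^t − α_t u^t` driven by uniformly bounded, `𝓕_{t+1}`-measurable update
directions `u^t` satisfying the drift condition
`⟨E[u^t | 𝓕_t], ∇F(x^t)⟩ ≥ min {β₁‖∇F(x^t)‖, β₂‖∇F(x^t)‖²}` a.s., with step sizes
`α_t = a/(t+1)^η`, `η ∈ [1/2,1)` and a suitably small step-size parameter `a`, for every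
`t ≥ 1` and `δ ∈ (0,1)`, with probability at least `1 − δ`,
`(1/t) Σ_{k=1}^t min {‖∇F(x^k)‖, ‖∇F(x^k)‖²}
  ≤ 4(log(1/δ) + F(x¹) − F⋆)/(aβ t^{1−η}) + (2aLC²/(β t^{1−η})) Σ_{k=1}^t (k+1)^{−2η}`,
where `β = min {β₁, β₂}`. -/
theorem stmt0 (d : ℕ) (hd : 1 ≤ d)
    {Ω : Type*} {m0 : MeasurableSpace Ω} (P : Measure Ω) [IsProbabilityMeasure P]
    (ℱ : Filtration ℕ m0)
    (F : EuclideanSpace ℝ (Fin d) → ℝ) (Fstar L C β₁ β₂ η a : ℝ)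
    (hFdiff : Differentiable ℝ F)
    (hlip : ∀ x y : EuclideanSpace ℝ (Fin d),
      ‖gradient F x - gradient F y‖ ≤ L * ‖x - y‖)
    (hFstar : IsGLB (Set.range F) Fstar)
    (hC : 0 < C) (hβ₁ : 0 < β₁) (hβ₂ : 0 < β₂)
    (hη1 : 1 / 2 ≤ η) (hη2 : η < 1) (ha0 : 0 < a)
    (x₀ : EuclideanSpace ℝ (Fin d))
    (ha : a ≤ min 1 (min (β₂ / (8 * C ^ 2))
      ((1 - η) * β₁ / (8 * C ^ 2 * (L * C + (1 - η) * ‖gradient F x₀‖)))))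
    (x u : ℕ → Ω → EuclideanSpace ℝ (Fin d))
    (hx1 : ∀ ω, x 1 ω = x₀)
    (humeas : ∀ t : ℕ, 1 ≤ t → StronglyMeasurable[ℱ (t + 1)] (u t))
    (hubdd : ∀ t : ℕ, 1 ≤ t → ∀ᵐ ω ∂P, ‖u t ω‖ ≤ C)
    (hrec : ∀ t : ℕ, 1 ≤ t → ∀ ω,
      x (t + 1) ω = x t ω - (a / ((t : ℝ) + 1) ^ η) • u t ω)
    (hdrift : ∀ t : ℕ, 1 ≤ t → ∀ᵐ ω ∂P,
      min (β₁ * ‖gradient F (x t ω)‖) (β₂ * ‖gradient F (x t ω)‖ ^ 2) ≤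
        ⟪(P[u t | ℱ t]) ω, gradient F (x t ω)⟫) :
    ∀ t : ℕ, 1 ≤ t → ∀ δ : ℝ, 0 < δ → δ < 1 →
      ENNReal.ofReal (1 - δ) ≤
        P {ω | (1 / (t : ℝ)) * ∑ k ∈ Finset.Icc 1 t,
            min ‖gradient F (x k ω)‖ (‖gradient F (x k ω)‖ ^ 2) ≤
          4 * (Real.log (1 / δ) + F x₀ - Fstar) /
              (a * min β₁ β₂ * (t : ℝ) ^ (1 - η)) +
            (2 * a * L * C ^ 2 / (min β₁ β₂ * (t : ℝ) ^ (1 - η))) *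
              ∑ k ∈ Finset.Icc 1 t, ((k : ℝ) + 1) ^ (-(2 * η))} := by
  have hL : 0 ≤ L := by
    have : Nonempty (Fin d) := ⟨⟨0, hd⟩⟩
    obtain ⟨v, hv⟩ := exists_ne (0 : EuclideanSpace ℝ (Fin d))
    have h := (norm_nonneg _).trans (hlip v 0)
    rw [sub_zero] at h
    exact nonneg_of_mul_nonneg_left h (norm_pos_iff.2 hv)
  have hη0 : 0 ≤ η := by linarith
  have hgcont : Continuous (gradient F) :=
    (LipschitzWith.of_dist_le_mul (K := L.toNNReal) fun x y => by
      simpa [dist_eq_norm, hL] using hlip x y).continuous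
  set α : ℕ → ℝ := fun k => a / ((k : ℝ) + 1) ^ η
  have hα0 (k : ℕ) : 0 ≤ α k := by positivity
  have hxmeas (t : ℕ) (ht : 1 ≤ t) : StronglyMeasurable[ℱ t] (x t) := by
    induction t, ht using Nat.le_induction with
    | base => rw [funext hx1]; exact stronglyMeasurable_const
    | succ t ht ih =>
      rw [funext (hrec t ht)]
      exact (ih.mono (ℱ.mono t.le_succ)).sub ((humeas t ht).const_smul (α t))
  have hgmeas (t : ℕ) (ht : 1 ≤ t) : StronglyMeasurable[ℱ t] (fun ω => gradient F (x t ω)) :=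
    hgcont.comp_stronglyMeasurable (hxmeas t ht)
  have hu : ∀ᵐ ω ∂P, ∀ t, 1 ≤ t → ‖u t ω‖ ≤ C :=
    ae_all_iff.2 fun t => ae_all_iff.2 (hubdd t)
  set G : ℕ → ℝ := fun t => ‖gradient F x₀‖ + L * C * a / (1 - η) * (t : ℝ) ^ (1 - η)
  have hgG (t : ℕ) (ht : 1 ≤ t) : ∀ᵐ ω ∂P, ‖gradient F (x t ω)‖ ≤ G t := by
    filter_upwards [hu] with ω h
    simpa only [hx1] using norm_gradient_iterate_le (x := fun t => x t ω) hlip hL hC.le hη0 hη2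
      ha0.le h (fun t ht => hrec t ht ω) ht
  set Y : ℕ → Ω → ℝ := fun k ω => α k * ⟪u k ω, gradient F (x k ω)⟫
  set z : ℕ → Ω → ℝ := fun k ω =>
    α k * min (β₁ * ‖gradient F (x k ω)‖) (β₂ * ‖gradient F (x k ω)‖ ^ 2)
  set c : ℕ → Ω → ℝ := fun k ω => α k * C * ‖gradient F (x k ω)‖
  have hinner (k : ℕ) (hk : 1 ≤ k) : StronglyMeasurable[ℱ (k + 1)]
      (fun ω => ⟪u k ω, gradient F (x k ω)⟫) :=
    (humeas k hk).inner ((hgmeas k hk).mono (ℱ.mono k.le_succ))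
  have hYc (k : ℕ) (hk : 1 ≤ k) : ∀ᵐ ω ∂P, |Y k ω| ≤ c k ω := by
    filter_upwards [hubdd k hk] with ω h
    simp only [Y, c]
    rw [abs_mul, abs_of_nonneg (hα0 k), mul_assoc]
    refine mul_le_mul_of_nonneg_left ((abs_real_inner_le_norm _ _).trans ?_) (hα0 k)
    gcongr
  have hzY (k : ℕ) (hk : 1 ≤ k) : ∀ᵐ ω ∂P, z k ω ≤ (P[Y k | ℱ k]) ω := by
    have huint : Integrable (u k) P :=
      .of_bound ((humeas k hk).mono (ℱ.le _)).aestronglyMeasurable C (hubdd k hk)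
    have hint : Integrable (fun ω => ⟪u k ω, gradient F (x k ω)⟫) P := by
      refine .of_bound ((hinner k hk).mono (ℱ.le _)).aestronglyMeasurable (C * G k) ?_
      filter_upwards [hubdd k hk, hgG k hk] with ω h1 h2
      exact (norm_inner_le_norm _ _).trans (by gcongr)
    have h1 := condExp_bilin_of_stronglyMeasurable_right (μ := P)
      (innerSL ℝ (E := EuclideanSpace ℝ (Fin d))) (hgmeas k hk) hint huint
    have h2 := condExp_smul (μ := P) (α k) (fun ω => ⟪u k ω, gradient F (x k ω)⟫) (ℱ k)
    filter_upwards [h1, h2, hdrift k hk] with ω h1 h2 h3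
    have h4 : (P[Y k | ℱ k]) ω = α k * ⟪(P[u k | ℱ k]) ω, gradient F (x k ω)⟫ :=
      h2.trans (congrArg (α k * ·) h1)
    rw [h4]
    exact mul_le_mul_of_nonneg_left h3 (hα0 k)
  have hcz (k : ℕ) (hk : 1 ≤ k) : ∀ᵐ ω ∂P, c k ω ^ 2 ≤ z k ω / 2 := by
    filter_upwards [hgG k hk] with ω h
    have h1 : c k ω ^ 2 ≤ z k ω / 8 :=
      sq_step_mul_le_drift hC hL hη1 hη2 ha0 (norm_nonneg _) ha hk (norm_nonneg _) h
    linarith [sq_nonneg (c k ω)]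
  intro t ht δ hδ _
  obtain ⟨hSmeas, hSint, hSle⟩ := integral_exp_sum_half_sub_le_one (P := P) (ℱ := ℱ)
    (Y := Y) (z := z) (c := c) (K := fun k => α k * C * G k)
    (fun k hk => (hinner k hk).const_mul (α k))
    (fun k hk => (show Continuous fun v : EuclideanSpace ℝ (Fin d) =>
      α k * min (β₁ * ‖v‖) (β₂ * ‖v‖ ^ 2) by fun_prop).comp_stronglyMeasurable (hgmeas k hk))
    (fun k hk => (hgmeas k hk).norm.const_mul (α k * C))
    (fun k hk => by
      filter_upwards [hgG k hk] with ω h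
      exact mul_le_mul_of_nonneg_left h (mul_nonneg (hα0 k) hC.le))
    hYc hzY hcz t
  refine (ofReal_one_sub_le_measure_lt_log (hSmeas.mono (ℱ.le _)).measurable hSint hSle hδ).trans
    (measure_mono_ae ?_)
  filter_upwards [hu] with ω h hlog
  have hlog' : ∑ k ∈ Finset.Icc 1 t, z k ω / 2 - ∑ k ∈ Finset.Icc 1 t, Y k ω <
      Real.log (1 / δ) := by
    rw [← Finset.sum_sub_distrib]
    exact hlog
  have hdesc := iterate_le_sub_sum_inner (x := fun t => x t ω) hFdiff hlip hL h
    (fun t ht => hrec t ht ω) t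
  have hlow : Fstar ≤ F (x (t + 1) ω) := hFstar.1 ⟨_, rfl⟩
  have hsq : ∑ k ∈ Finset.Icc 1 t, (a / ((k : ℝ) + 1) ^ η) ^ 2 =
      a ^ 2 * ∑ k ∈ Finset.Icc 1 t, ((k : ℝ) + 1) ^ (-(2 * η)) := by
    rw [Finset.mul_sum]
    refine Finset.sum_congr rfl fun k _ => ?_
    have hk : (0 : ℝ) ≤ (k : ℝ) + 1 := by positivity
    rw [div_pow, Real.rpow_neg hk, mul_comm 2 η, Real.rpow_mul hk, Real.rpow_two, div_eq_mul_inv]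
  simp only [hx1, hsq] at hdesc
  refine (average_le_of_weighted_sum_le (n := fun k => ‖gradient F (x k ω)‖)
    (R := Real.log (1 / δ) + F x₀ - Fstar + L * C ^ 2 / 2 *
      (a ^ 2 * ∑ k ∈ Finset.Icc 1 t, ((k : ℝ) + 1) ^ (-(2 * η))))
    ht hβ₁ hβ₂ hη0 hη2.le ha0 (fun k => norm_nonneg _) (by linarith)).trans (le_of_eq ?_)
  have hβ : 0 < min β₁ β₂ := lt_min hβ₁ hβ₂
  have ht0 : (0 : ℝ) < t := by exact_mod_cast ht
  field_simp
  ring
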